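/- Let k ≥ 2, let M be a valid connection k-pattern, let b : [k] → [n_b] be a nondecreasing bucket assignment with O_b = {{i, i+1} : b(i) = b(i+1)}, and let D = ([k], I_M ∪ O_b) be the dependence graph. If S ⊆ [k] contains at least one endpoint of every edge of O_b, then every vertex of the graph D − S (the subgraph induced on [k] \ S) has degree at most 2, and consequently the treewidth of D − S is at most 2. -/

import Mathlib

/-- A perfect matching on the vertex set `V`, given by its edge set. -/
def IsPerfectMatchingEdgeSet {V : Type*} (M : Set (Sym2 V)) : Prop :=
  (∀ e ∈ M, ¬ e.IsDiag) ∧ ∀ v : V, ∃! e, e ∈ M ∧ v ∈ e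

/-- The identification pairs for validity: (1-indexed) `2i ~ (2i+1) mod 2k`. -/
def nuEdges (k : ℕ) : Set (Sym2 (Fin (2 * k))) :=
  { e | ∃ j : Fin k,
      e = s((⟨(2 * j.val + 1) % (2 * k), Nat.mod_lt _ (by have := j.isLt; omega)⟩ : Fin (2 * k)),
            (⟨(2 * j.val + 2) % (2 * k), Nat.mod_lt _ (by have := j.isLt; omega)⟩ : Fin (2 * k))) }

/-- A valid connection `k`-pattern. -/
def IsValidPattern (k : ℕ) (M : Set (Sym2 (Fin (2 * k)))) : Prop :=
  IsPerfectMatchingEdgeSet M ∧ (SimpleGraph.fromEdgeSet (M ∪ nuEdges k)).Connected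

/-- `I_M`: the edge set on `[k]` obtained from `M` by identifying `2i-1, 2i ↦ i`
(0-indexed: `v ↦ ⌊v/2⌋`), discarding loops. -/
def IM (k : ℕ) (M : Set (Sym2 (Fin (2 * k)))) : Set (Sym2 (Fin k)) :=
  { e | ¬ e.IsDiag ∧ ∃ e' ∈ M,
      Sym2.map (fun v : Fin (2 * k) => (⟨v.val / 2, by have := v.isLt; omega⟩ : Fin k)) e' = e }

/-- `O_b = {{i, i+1} : b i = b (i+1)}`, the order dependencies. -/
def Ob (k nb : ℕ) (b : Fin k → Fin nb) : Set (Sym2 (Fin k)) :=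
  { e | ∃ (i : ℕ) (h : i + 1 < k),
      b ⟨i, by omega⟩ = b ⟨i + 1, h⟩ ∧ e = s((⟨i, by omega⟩ : Fin k), (⟨i + 1, h⟩ : Fin k)) }

/-- `G` has treewidth at most `w`. -/
def TreewidthAtMost {V : Type*} (G : SimpleGraph V) (w : ℕ) : Prop :=
  ∃ (ι : Type) (T : SimpleGraph ι) (X : ι → Finset V),
    T.IsTree ∧ (∀ v, ∃ t, v ∈ X t) ∧
      (∀ e ∈ G.edgeSet, ∃ t, ∀ v ∈ e, v ∈ X t) ∧
      (∀ v : V, (T.induce { t | v ∈ X t }).Connected) ∧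
      (∀ t, (X t).card ≤ w + 1)

namespace SimpleGraph

/-- The graph obtained from `T` by adding a new vertex `none` adjacent to `t₀` only. -/
def attachLeaf {ι : Type*} (T : SimpleGraph ι) (t₀ : ι) : SimpleGraph (Option ι) :=
  T.map Function.Embedding.some ⊔ edge (some t₀) none

lemma attachLeaf_adj_some {ι : Type*} {T : SimpleGraph ι} {t₀ a b : ι} (h : T.Adj a b) :
    (T.attachLeaf t₀).Adj (some a) (some b) :=
  Or.inl ⟨by simpa using h.ne, a, b, h, rfl, rfl⟩

lemma attachLeaf_adj_none {ι : Type*} (T : SimpleGraph ι) (t₀ : ι) :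
    (T.attachLeaf t₀).Adj (some t₀) none :=
  Or.inr (by simp [edge_adj])

lemma IsAcyclic.map_some {ι : Type*} [Nonempty ι] {T : SimpleGraph ι} (hT : T.IsAcyclic) :
    (T.map (Function.Embedding.some : ι ↪ Option ι)).IsAcyclic := by
  rw [isAcyclic_iff_forall_adj_isBridge] at hT ⊢
  rintro _ _ ⟨-, a, b, hab, rfl, rfl⟩
  have hbridge := hT hab
  rw [isBridge_iff] at hbridge ⊢
  intro hreach
  let f : (T.map (Function.Embedding.some : ι ↪ Option ι)).deleteEdges {s(some a, some b)} →g
      T.deleteEdges {s(a, b)} :=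
    { toFun := fun o => o.getD (Classical.arbitrary ι)
      map_rel' := by
        rintro _ _ ⟨⟨-, x, y, hxy, rfl, rfl⟩, hne⟩
        refine ⟨hxy, fun h => hne ?_⟩
        simpa using h }
  exact hbridge (hreach.map f)

lemma induce_attachLeaf_connected {ι : Type*} {T : SimpleGraph ι} {t₀ : ι} {A : Set ι}
    (hA : (T.induce A).Connected) : ((T.attachLeaf t₀).induce (some '' A)).Connected := by
  refine hA.map (H := (T.attachLeaf t₀).induce (some '' A))
    { toFun := fun a => ⟨some a.1, a.1, a.2, rfl⟩
      map_rel' := fun h => attachLeaf_adj_some h } ?_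
  rintro ⟨_, a, ha, rfl⟩
  exact ⟨⟨a, ha⟩, rfl⟩

lemma induce_singleton_connected {V : Type*} (G : SimpleGraph V) (v : V) :
    (G.induce {v}).Connected :=
  ⟨Preconnected.of_subsingleton⟩

lemma induce_attachLeaf_union_none_connected {ι : Type*} {T : SimpleGraph ι} {t₀ : ι}
    {A : Set ι} (hA : (T.induce A).Connected) (h₀ : t₀ ∈ A) :
    ((T.attachLeaf t₀).induce (some '' A ∪ {none})).Connected :=
  connected_induce_union (induce_attachLeaf_connected hA).preconnected
    (induce_singleton_connected _ _).preconnected ⟨t₀, h₀, rfl⟩ rfl (attachLeaf_adj_none T t₀)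

lemma IsTree.attachLeaf {ι : Type*} {T : SimpleGraph ι} (hT : T.IsTree) (t₀ : ι) :
    (T.attachLeaf t₀).IsTree := by
  have : Nonempty ι := ⟨t₀⟩
  refine ⟨?_, ?_⟩
  · have h := induce_attachLeaf_union_none_connected (t₀ := t₀)
      ((induceUnivIso T).connected_iff.2 hT.connected) (Set.mem_univ t₀)
    have huniv : some '' (Set.univ : Set ι) ∪ {none} = Set.univ := by
      ext (_ | _) <;> simp
    rw [huniv] at h
    exact (induceUnivIso _).connected_iff.1 h
  · refine IsAcyclic.sup_edge_of_not_reachable ?_ hT.isAcyclic.map_some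
    refine not_reachable_of_neighborSet_right_eq_empty (by simp) ?_
    ext x
    simp only [mem_neighborSet, Set.mem_empty_iff_false, iff_false]
    rintro ⟨-, a, b, -, h, -⟩
    exact Option.some_ne_none a h

/-- `G` has a tree decomposition of width at most `w` whose bags are contained in `s`, where
the vertices outside `s` are ignored. -/
def TreewidthAtMostOn {V : Type*} (G : SimpleGraph V) (s : Finset V) (w : ℕ) : Prop :=
  ∃ (ι : Type) (T : SimpleGraph ι) (X : ι → Finset V),
    T.IsTree ∧ (∀ t, X t ⊆ s) ∧ (∀ u v, G.Adj u v → ∃ t, u ∈ X t ∧ v ∈ X t) ∧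
      (∀ v ∈ s, (T.induce { t | v ∈ X t }).Connected) ∧ (∀ t, (X t).card ≤ w + 1)

/-- Eliminating a vertex `v` whose neighbours lie in a set `N` of at most two vertices
that is a clique of the remaining graph. -/
lemma TreewidthAtMostOn.insert_vertex {V : Type*} [DecidableEq V] {G H : SimpleGraph V}
    {s N : Finset V} {v : V} (hH : H.TreewidthAtMostOn s 2) (hv : v ∉ s) (hNs : N ⊆ s)
    (hN : N.card ≤ 2) (hclique : H.IsClique N)
    (hG : ∀ x y, G.Adj x y → H.Adj x y ∨ (x = v ∧ y ∈ N) ∨ (y = v ∧ x ∈ N)) :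
    G.TreewidthAtMostOn (insert v s) 2 := by
  obtain ⟨ι, T, X, hT, hXs, hedge, hconn, hcard⟩ := hH
  have hbag : ∃ t₀, N ⊆ X t₀ := by
    obtain ⟨t⟩ := hT.connected.nonempty
    have hN' : N.card = 0 ∨ N.card = 1 ∨ N.card = 2 := by omega
    rcases hN' with h | h | h
    · rw [Finset.card_eq_zero] at h
      exact ⟨t, by simp [h]⟩
    · obtain ⟨a, rfl⟩ := Finset.card_eq_one.1 h
      obtain ⟨t, ht⟩ := (hconn a (hNs (by simp))).nonempty
      exact ⟨t, by simpa using ht⟩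
    · obtain ⟨a, b, hab, rfl⟩ := Finset.card_eq_two.1 h
      obtain ⟨t, ha, hb⟩ := hedge a b (hclique (by simp) (by simp) hab)
      exact ⟨t, by simp [Finset.insert_subset_iff, ha, hb]⟩
  obtain ⟨t₀, ht₀⟩ := hbag
  refine ⟨Option ι, T.attachLeaf t₀, fun o => o.elim (insert v N) X, hT.attachLeaf t₀,
    ?_, ?_, ?_, ?_⟩
  · rintro (_ | t)
    · exact Finset.insert_subset_insert v hNs
    · exact (hXs t).trans (Finset.subset_insert v s)
  · intro x y hxy
    rcases hG x y hxy with h | ⟨rfl, h⟩ | ⟨rfl, h⟩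
    · obtain ⟨t, ht⟩ := hedge x y h
      exact ⟨some t, ht⟩
    · exact ⟨none, by simp [h]⟩
    · exact ⟨none, by simp [h]⟩
  · intro u hu
    rcases Finset.mem_insert.1 hu with rfl | hus
    · have hset : { o : Option ι | u ∈ o.elim (insert u N) X } = {none} := by
        ext (_ | t)
        · simp
        · simpa using fun h => hv (hXs t h)
      rw [hset]
      exact induce_singleton_connected _ _
    · have huv : u ≠ v := fun h => hv (h ▸ hus)
      by_cases huN : u ∈ N
      · have hset : { o : Option ι | u ∈ o.elim (insert v N) X } =
            some '' { t | u ∈ X t } ∪ {none} := by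
          ext (_ | t) <;> simp [huN]
        rw [hset]
        exact induce_attachLeaf_union_none_connected (hconn u hus) (ht₀ huN)
      · have hset : { o : Option ι | u ∈ o.elim (insert v N) X } = some '' { t | u ∈ X t } := by
          ext (_ | t) <;> simp [huN, huv]
        rw [hset]
        exact induce_attachLeaf_connected (hconn u hus)
  · rintro (_ | t)
    · exact (Finset.card_insert_le v N).trans (by omega)
    · exact hcard t

/-- The graph obtained from `G` by eliminating `v`: the vertex `v` is isolated and its
neighbours are made pairwise adjacent. -/
def eliminate {V : Type*} (G : SimpleGraph V) (v : V) : SimpleGraph V where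
  Adj x y := x ≠ v ∧ y ≠ v ∧ x ≠ y ∧ (G.Adj x y ∨ (G.Adj v x ∧ G.Adj v y))
  symm := ⟨fun _ _ ⟨hx, hy, hne, h⟩ => ⟨hy, hx, hne.symm, h.imp Adj.symm And.symm⟩⟩
  loopless := ⟨fun _ h => h.2.2.1 rfl⟩

lemma ncard_neighborSet_eliminate_le {V : Type*} [Finite V] {G : SimpleGraph V}
    (hdeg : ∀ x, (G.neighborSet x).ncard ≤ 2) (v x : V) :
    ((G.eliminate v).neighborSet x).ncard ≤ 2 := by
  by_cases hvx : G.Adj v x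
  · have hsub : (G.eliminate v).neighborSet x ⊆
        (G.neighborSet x \ {v}) ∪ (G.neighborSet v \ {x}) := by
      rintro y ⟨-, hyv, hxy, h | h⟩
      · exact Or.inl ⟨h, hyv⟩
      · exact Or.inr ⟨h.2, hxy.symm⟩
    have h₁ := Set.ncard_sdiff_singleton_add_one (s := G.neighborSet x) (a := v) hvx.symm
    have h₂ := Set.ncard_sdiff_singleton_add_one (s := G.neighborSet v) (a := x) hvx
    have h₃ := Set.ncard_le_ncard hsub
    have h₄ := Set.ncard_union_le (G.neighborSet x \ {v}) (G.neighborSet v \ {x})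
    have h₅ := hdeg x
    have h₆ := hdeg v
    omega
  · refine (Set.ncard_le_ncard ?_).trans (hdeg x)
    rintro y ⟨-, -, -, h | h⟩
    · exact h
    · exact absurd h.1 hvx

theorem treewidthAtMostOn_two_of_ncard_neighborSet_le_two {V : Type*} [Finite V]
    (s : Finset V) (G : SimpleGraph V) (hs : ∀ x y, G.Adj x y → x ∈ s)
    (hdeg : ∀ x, (G.neighborSet x).ncard ≤ 2) : G.TreewidthAtMostOn s 2 := by
  classical
  induction s using Finset.induction_on generalizing G with
  | empty =>
    exact ⟨Unit, ⊥, fun _ => ∅, IsTree.of_subsingleton, by simp,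
      fun u v h => absurd (hs u v h) (by simp), by simp, by simp⟩
  | insert v s hv ih =>
    have hmem : ∀ x y, G.Adj x y → x ≠ v → x ∈ s := fun x y h hx =>
      (Finset.mem_insert.1 (hs x y h)).resolve_left hx
    have hN : ∀ x, x ∈ (Set.toFinite (G.neighborSet v)).toFinset ↔ G.Adj v x := by simp
    refine (ih (G.eliminate v) ?_ (ncard_neighborSet_eliminate_le hdeg v)).insert_vertex
      (N := (Set.toFinite (G.neighborSet v)).toFinset) hv ?_ ?_ ?_ ?_
    · rintro x y ⟨hx, -, -, h | h⟩
      · exact hmem x y h hx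
      · exact hmem x v h.1.symm hx
    · intro x hx
      rw [hN] at hx
      exact hmem x v hx.symm hx.ne'
    · rw [← Set.ncard_eq_toFinset_card]
      exact hdeg v
    · intro x hx y hy hxy
      rw [Finset.mem_coe, hN] at hx hy
      exact ⟨hx.ne', hy.ne', hxy, Or.inr ⟨hx, hy⟩⟩
    · intro x y hxy
      rw [hN, hN]
      by_cases hx : x = v
      · subst hx
        exact Or.inr (Or.inl ⟨rfl, hxy⟩)
      · by_cases hy : y = v
        · subst hy
          exact Or.inr (Or.inr ⟨rfl, hxy.symm⟩)
        · exact Or.inl ⟨hx, hy, hxy.ne, Or.inl hxy⟩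

end SimpleGraph

theorem treewidthAtMost_two_of_ncard_neighborSet_le_two {V : Type*} [Finite V]
    (G : SimpleGraph V) (hdeg : ∀ x, (G.neighborSet x).ncard ≤ 2) : TreewidthAtMost G 2 := by
  have := Fintype.ofFinite V
  obtain ⟨ι, T, X, hT, -, hedge, hconn, hcard⟩ :=
    SimpleGraph.treewidthAtMostOn_two_of_ncard_neighborSet_le_two Finset.univ G (by simp) hdeg
  refine ⟨ι, T, X, hT, fun v => ?_, fun e he => ?_, fun v => hconn v (Finset.mem_univ v), hcard⟩
  · obtain ⟨t, ht⟩ := (hconn v (Finset.mem_univ v)).nonempty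
    exact ⟨t, ht⟩
  · induction e using Sym2.ind with
    | _ x y =>
      obtain ⟨t, hx, hy⟩ := hedge x y he
      refine ⟨t, fun v hv => ?_⟩
      rcases Sym2.mem_iff.1 hv with rfl | rfl
      · exact hx
      · exact hy

lemma IsPerfectMatchingEdgeSet.eq_of_mk_mem {V : Type*} {M : Set (Sym2 V)}
    (hM : IsPerfectMatchingEdgeSet M) {a b c : V} (hb : s(a, b) ∈ M) (hc : s(a, c) ∈ M) :
    b = c := by
  have h := (hM.2 a).unique ⟨hb, Sym2.mem_mk_left a b⟩ ⟨hc, Sym2.mem_mk_left a c⟩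
  exact Sym2.congr_right.1 h

lemma IsPerfectMatchingEdgeSet.exists_partner {V : Type*} {M : Set (Sym2 V)}
    (hM : IsPerfectMatchingEdgeSet M) : ∃ p : V → V, ∀ a c, s(a, c) ∈ M → c = p a := by
  have h : ∀ a, ∃ b, s(a, b) ∈ M := by
    intro a
    obtain ⟨e, ⟨he, b, rfl⟩, -⟩ := hM.2 a
    exact ⟨b, he⟩
  choose p hp using h
  exact ⟨p, fun a c hc => hM.eq_of_mk_mem hc (hp a)⟩

lemma ncard_setOf_mk_mem_IM_le_two {k : ℕ} {M : Set (Sym2 (Fin (2 * k)))}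
    (hM : IsPerfectMatchingEdgeSet M) (v : Fin k) : { w | s(v, w) ∈ IM k M }.ncard ≤ 2 := by
  obtain ⟨p, hp⟩ := hM.exists_partner
  let q : Fin (2 * k) → Fin k := fun a => ⟨a.val / 2, by have := a.isLt; omega⟩
  let l : Fin (2 * k) := ⟨2 * v.val, by have := v.isLt; omega⟩
  let r : Fin (2 * k) := ⟨2 * v.val + 1, by have := v.isLt; omega⟩
  have hq : ∀ a, q a = v → a = l ∨ a = r := by
    intro a ha
    have ha' : a.val / 2 = v.val := congrArg Fin.val ha
    have : a.val = 2 * v.val ∨ a.val = 2 * v.val + 1 := by omega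
    exact this.imp Fin.ext Fin.ext
  have key : ∀ a c, s(a, c) ∈ M → q a = v → q c = q (p l) ∨ q c = q (p r) := by
    intro a c hac ha
    rw [hp a c hac]
    rcases hq a ha with rfl | rfl
    · exact Or.inl rfl
    · exact Or.inr rfl
  have hsub : { w | s(v, w) ∈ IM k M } ⊆ {q (p l), q (p r)} := by
    rintro w ⟨-, e, he, hew⟩
    induction e using Sym2.ind with
    | _ a c =>
      have hew' : s(q a, q c) = s(v, w) := hew
      rcases Sym2.eq_iff.1 hew' with ⟨ha, rfl⟩ | ⟨rfl, hc⟩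
      · exact key a c he ha
      · exact key c a (Sym2.eq_swap ▸ he) hc
  refine (Set.ncard_le_ncard hsub).trans ((Set.ncard_insert_le _ _).trans ?_)
  rw [Set.ncard_singleton]

/-- If `S ⊆ [k]` contains an endpoint of every edge of `O_b`,
then in `D − S` (the subgraph of the dependence graph `D = ([k], I_M ∪ O_b)`
induced on `[k] \ S`) every vertex has degree at most 2, and consequently
`D − S` has treewidth at most 2. -/
theorem stmt_17 (k nb : ℕ) (hk : 2 ≤ k)
    (M : Set (Sym2 (Fin (2 * k)))) (hM : IsValidPattern k M)
    (b : Fin k → Fin nb) (hb : Monotone b)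
    (S : Set (Fin k)) (hS : ∀ e ∈ Ob k nb b, ∃ v ∈ e, v ∈ S) :
    (∀ v : ↥(Sᶜ),
      (((SimpleGraph.fromEdgeSet (IM k M ∪ Ob k nb b)).induce Sᶜ).neighborSet v).ncard ≤ 2) ∧
    TreewidthAtMost ((SimpleGraph.fromEdgeSet (IM k M ∪ Ob k nb b)).induce Sᶜ) 2 := by
  have hdeg : ∀ v : ↥(Sᶜ),
      (((SimpleGraph.fromEdgeSet (IM k M ∪ Ob k nb b)).induce Sᶜ).neighborSet v).ncard ≤ 2 := by
    intro v
    rw [← Set.ncard_image_of_injective _ Subtype.val_injective]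
    refine (Set.ncard_le_ncard ?_).trans (ncard_setOf_mk_mem_IM_le_two hM.1 v.1)
    rintro _ ⟨w, ⟨hI | hO, -⟩, rfl⟩
    · exact hI
    · obtain ⟨x, hx, hxS⟩ := hS _ hO
      rcases Sym2.mem_iff.1 hx with rfl | rfl
      · exact absurd hxS v.2
      · exact absurd hxS w.2
  exact ⟨hdeg, treewidthAtMost_two_of_ncard_neighborSet_le_two _ hdeg⟩
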